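/- arXiv:2102.03426 — 10 statements merged into one kernel-verified Lean document; each statement's English description precedes it below -/
import Mathlib

section
/- Let V be a finite set and E a directed acyclic graph on V (a relation on V whose transitive closure is irreflexive). Write pa(i) = {j : (j,i) ∈ E} and an(i) = {j : there is a directed path in E from j to i}. Fix k ≥ 1 and let Z : V → Fin k. Then a map X : V → Fin k satisfies the max-linear structural equations X_i = Z_i ∨ (max_{j ∈ pa(i)} X_j) for all i ∈ V (where the maximum over an empty parent set is 0) if and only if X_i = max_{j ∈ {i} ∪ an(i)} Z_j for all i ∈ V. In particular the structural equations have a unique solution. -/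
open scoped Classical

/-- The maximum of `Z` over `{i} ∪ an(i)` solves the max-linear structural equations. -/
theorem sup_insert_ancestors_eq {V α : Type*} [Fintype V] [SemilatticeSup α] [OrderBot α]
    (E : V → V → Prop) (Z : V → α) (i : V) :
    (insert i (Finset.univ.filter (fun j => Relation.TransGen E j i))).sup Z =
      Z i ⊔ (Finset.univ.filter (fun j => E j i)).sup
        (fun j => (insert j (Finset.univ.filter (fun l => Relation.TransGen E l j))).sup Z) := by
  rw [Finset.sup_insert]
  congr 1
  apply le_antisymm
  · refine Finset.sup_le fun l hl => ?_
    obtain ⟨j, hlj, hji⟩ := Relation.TransGen.tail'_iff.1 (Finset.mem_filter.1 hl).2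
    refine le_trans (Finset.le_sup (f := Z) ?_) (Finset.le_sup
      (f := fun j => (insert j (Finset.univ.filter (fun l => Relation.TransGen E l j))).sup Z)
      (Finset.mem_filter.2 ⟨Finset.mem_univ j, hji⟩))
    rcases Relation.reflTransGen_iff_eq_or_transGen.1 hlj with h | h
    · simp [h]
    · simp [h]
  · refine Finset.sup_le fun j hj => Finset.sup_mono fun l hl => ?_
    have hji : E j i := (Finset.mem_filter.1 hj).2
    refine Finset.mem_filter.2 ⟨Finset.mem_univ l, ?_⟩
    rcases Finset.mem_insert.1 hl with rfl | h
    · exact .single hji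
    · exact (Finset.mem_filter.1 h).2.tail hji

/-- For a DAG `E` on a finite vertex set `V` and discrete innovations
`Z : V → Fin (k+1)`, a map `X` satisfies the max-linear structural equations
`X i = Z i ⊔ (max of X over parents of i)` (empty max being `0 = ⊥`) if and only if
`X i = max of Z over {i} ∪ an(i)`.  In particular the structural equations have a
unique solution. -/
theorem stmt_0 {V : Type*} [Fintype V] (E : V → V → Prop)
    (hacyc : ∀ i : V, ¬ Relation.TransGen E i i) (k : ℕ)
    (Z X : V → Fin (k + 1)) :
    (∀ i : V, X i = Z i ⊔ (Finset.univ.filter (fun j => E j i)).sup X) ↔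
      (∀ i : V,
        X i = (insert i (Finset.univ.filter (fun j => Relation.TransGen E j i))).sup Z) := by
  constructor
  · intro h i
    have : Std.Irrefl (Relation.TransGen E) := ⟨hacyc⟩
    induction i using
      (Finite.wellFounded_of_trans_of_irrefl (Relation.TransGen E)).induction with
    | _ i ih =>
      rw [h i, sup_insert_ancestors_eq]
      congr 1
      exact Finset.sup_congr rfl fun j hj => ih j (.single (Finset.mem_filter.1 hj).2)
  · intro h i
    rw [h i, sup_insert_ancestors_eq]
    congr 1
    exact Finset.sup_congr rfl fun j _ => (h j).symm
end

section
/- Let V be a finite set and E a directed acyclic graph on V, with an(i) the set of ancestors of i, and fix k ≥ 1. A map g : V → Fin k is attainable by the discrete max-linear Bayesian network on E, i.e. there exists Z : V → Fin k with g_i = max_{j ∈ {i} ∪ an(i)} Z_j for all i ∈ V, if and only if g is monotone with respect to the reachability order (for all i,j ∈ V, j ∈ an(i) implies g_j ≤ g_i). Hence the state space of the k-state D-MLBN is exactly the set of order-preserving maps from the transitive closure poset of E to the chain Fin k. -/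
open scoped Classical

/-- For a DAG `E` on a finite vertex set `V` and `k ≥ 1`, a map
`g : V → Fin (k+1)` is attainable by the discrete max-linear Bayesian network on `E`
(i.e. `g i = max_{j ∈ {i} ∪ an(i)} Z j` for some innovations `Z`) if and only if `g` is
order-preserving for the reachability order (the transitive closure poset of `E`). -/
theorem stmt_2 {V : Type*} [Fintype V] (E : V → V → Prop)
    (hacyc : ∀ i : V, ¬ Relation.TransGen E i i) (k : ℕ)
    (g : V → Fin (k + 1)) :
    (∃ Z : V → Fin (k + 1), ∀ i : V,
        g i = (insert i (Finset.univ.filter (fun j => Relation.TransGen E j i))).sup Z) ↔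
      (∀ i j : V, Relation.TransGen E j i → g j ≤ g i) := by
  constructor
  · rintro ⟨Z, hZ⟩ i j hji
    rw [hZ j, hZ i]
    refine Finset.sup_mono fun a ha => ?_
    simp only [Finset.mem_insert, Finset.mem_filter, Finset.mem_univ, true_and] at ha ⊢
    rcases ha with rfl | ha
    · exact Or.inr hji
    · exact Or.inr (ha.trans hji)
  · intro hg
    refine ⟨g, fun i => le_antisymm (Finset.le_sup (Finset.mem_insert_self i _)) ?_⟩
    refine Finset.sup_le fun a ha => ?_
    simp only [Finset.mem_insert, Finset.mem_filter, Finset.mem_univ, true_and] at ha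
    rcases ha with rfl | ha
    · exact le_rfl
    · exact hg i a ha
end

section
/- Let V be a finite set and E a directed acyclic graph on V, with parent sets pa(i) and reachability order ≤ (the transitive closure poset D^tr). Let g ⊆ V be an order ideal of D^tr and let φ(g) : V → Fin 2 be defined by φ(g)_i = 0 if i ∈ g and φ(g)_i = 1 if i ∉ g. Fix i ∈ V and real numbers θ_0, θ_1 with θ_0 + θ_1 = 1. Then the CBN local factor b_i(g; θ_0, θ_1) equals the D-MLBN local factor c_i(φ(g); θ_1, θ_0) with the two parameters interchanged, where: b_i(g; θ_0, θ_1) = θ_1 if every j < i lies in g and i ∈ g; = θ_0 if every j < i lies in g and i ∉ g; = 1 if some j < i is not in g and i ∉ g; = 0 otherwise; and, setting M_i = max_{j ∈ pa(i)} φ(g)_j (with M_i = 0 if pa(i) = ∅), c_i(φ(g); θ_1, θ_0) = 0 if φ(g)_i < M_i; = θ_1 if φ(g)_i = M_i = 0; = θ_1 + θ_0 if φ(g)_i = M_i = 1; = θ_0 if φ(g)_i = 1 > M_i = 0. -/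
open scoped Classical

/-- The CBN local factor `b_i(g; θ0, θ1)` on the transitive closure poset of the DAG `E`:
`θ1` if every `j < i` (i.e. every strict ancestor of `i`) lies in `g` and `i ∈ g`;
`θ0` if every `j < i` lies in `g` and `i ∉ g`; `0` if some `j < i` is not in `g` and
`i ∈ g`; `1` if some `j < i` is not in `g` and `i ∉ g`. -/
noncomputable def cbnFactor {V : Type*} (E : V → V → Prop) (g : Set V) (i : V)
    (θ0 θ1 : ℝ) : ℝ :=
  if ∀ j : V, Relation.TransGen E j i → j ∈ g then (if i ∈ g then θ1 else θ0)
  else (if i ∈ g then 0 else 1)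

/-- The D-MLBN local factor `c_i(h; θ)` of formula (4): with
`M_i = max_{j ∈ pa(i)} h j` (`= 0` for empty parent set), it is `0` if `h i < M_i`,
`θ_0 + ⋯ + θ_{M_i}` if `h i = M_i`, and `θ_{h i}` if `h i > M_i`. -/
noncomputable def dmlbnFactor {V : Type*} [Fintype V] (E : V → V → Prop) {k : ℕ}
    (h : V → Fin (k + 1)) (i : V) (θ : Fin (k + 1) → ℝ) : ℝ :=
  if h i < (Finset.univ.filter (fun j => E j i)).sup h then 0
  else if h i = (Finset.univ.filter (fun j => E j i)).sup h then
    ∑ ℓ ∈ Finset.Iic ((Finset.univ.filter (fun j => E j i)).sup h), θ ℓ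
  else θ (h i)

/-- The parents of a vertex all lie in an order ideal iff all its strict ancestors do. -/
theorem forall_transGen_mem_iff {V : Type*} {E : V → V → Prop} {g : Set V}
    (hg : ∀ i ∈ g, ∀ j : V, Relation.TransGen E j i → j ∈ g) (i : V) :
    (∀ j : V, Relation.TransGen E j i → j ∈ g) ↔ ∀ j : V, E j i → j ∈ g := by
  refine ⟨fun h j hj => h j (.single hj), fun h j hj => ?_⟩
  cases hj with
  | single hj => exact h j hj
  | tail hjk hki => exact hg _ (h _ hki) j hjk

/-- The maximum over `s` of the `0/1` indicator of the complement of `g`. -/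
theorem sup_ite_mem_zero_one {V : Type*} (s : Finset V) (g : Set V) :
    s.sup (fun v : V => if v ∈ g then (0 : Fin (1 + 1)) else 1) =
      if ∀ j ∈ s, j ∈ g then 0 else 1 := by
  split_ifs with h
  · exact Finset.sup_eq_bot_iff _ _ |>.2 fun j hj => if_pos (h j hj)
  · push Not at h
    obtain ⟨j, hj, hjg⟩ := h
    refine le_antisymm (Fin.le_last _) ?_
    have hle := Finset.le_sup (f := fun v : V => if v ∈ g then (0 : Fin (1 + 1)) else 1) hj
    rwa [if_neg hjg] at hle

/-- For a DAG `E`, an order ideal `g` of its transitive closure poset,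
a vertex `i`, and reals `θ0 + θ1 = 1`, the CBN local factor `b_i(g; θ0, θ1)` equals the
2-state D-MLBN local factor `c_i(φ(g); θ1, θ0)` with the two parameters interchanged,
where `φ(g)_i = 0` if `i ∈ g` and `1` otherwise. -/
theorem stmt_5 {V : Type*} [Fintype V] (E : V → V → Prop)
    (hacyc : ∀ i : V, ¬ Relation.TransGen E i i)
    (g : Set V) (hg : ∀ i ∈ g, ∀ j : V, Relation.TransGen E j i → j ∈ g)
    (i : V) (θ0 θ1 : ℝ) (hθ : θ0 + θ1 = 1) :
    cbnFactor E g i θ0 θ1 =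
      dmlbnFactor E (fun v : V => if v ∈ g then (0 : Fin 2) else 1) i
        (fun ℓ : Fin 2 => if ℓ = 0 then θ1 else θ0) := by
  have hsup := sup_ite_mem_zero_one (Finset.univ.filter (fun j => E j i)) g
  simp only [Finset.mem_filter, Finset.mem_univ, true_and,
    ← forall_transGen_mem_iff hg i] at hsup
  have hIic_zero : Finset.Iic (0 : Fin 2) = {0} := by decide
  have hIic_one : Finset.Iic (1 : Fin 2) = {0, 1} := by decide
  unfold cbnFactor dmlbnFactor
  rw [hsup]
  by_cases hanc : ∀ j : V, Relation.TransGen E j i → j ∈ g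
  · by_cases hi : i ∈ g <;> simp [if_pos hanc, hi, hIic_zero]
  · have hi : i ∉ g := fun hi => hanc (hg i hi)
    simp [if_neg hanc, hi, hIic_one, add_comm θ1 θ0, hθ]
end

section
/- Let V be a finite set and E a directed acyclic graph on V with parent sets pa(i) and ancestor sets an(i), and fix k ≥ 1. Let h : V → Fin k be a map that is NOT monotone with respect to the reachability order, i.e. there exist i ∈ V and j ∈ an(i) with h_j > h_i. Then for every choice of real parameters θ^{(i)} = (θ_0^{(i)},...,θ_{k-1}^{(i)}), the D-MLBN probability vanishes: ∏_{i ∈ V} c_i(h; θ^{(i)}) = 0, where, with M_i(h) = max_{j ∈ pa(i)} h_j (equal to 0 if pa(i) = ∅), c_i(h; θ) = 0 if h_i < M_i(h); = θ_0 + ··· + θ_{M_i(h)} if h_i = M_i(h); = θ_{h_i} if h_i > M_i(h). -/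
open scoped Classical

/-- The D-MLBN factor at `i` vanishes when some parent of `i` has a larger value. -/
theorem dmlbnFactor_eq_zero_of_lt {V : Type*} [Fintype V] {E : V → V → Prop} {k : ℕ}
    {h : V → Fin (k + 1)} {i j : V} (hji : E j i) (hlt : h i < h j) (θ : Fin (k + 1) → ℝ) :
    dmlbnFactor E h i θ = 0 :=
  if_pos (hlt.trans_le (Finset.le_sup (by simpa using hji)))

/-- A function that is strictly smaller at `i` than at an ancestor of `i` strictly decreases
along some edge. -/
theorem exists_edge_lt_of_transGen {V α : Type*} [LinearOrder α] {E : V → V → Prop}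
    {h : V → α} {i j : V} (hji : Relation.TransGen E j i) (hlt : h i < h j) :
    ∃ a b : V, E a b ∧ h b < h a := by
  by_contra! hmono
  have hle : Relation.TransGen (· ≤ ·) (h j) (h i) :=
    Relation.TransGen.lift h hmono _ _ hji
  rw [Relation.transGen_eq_self] at hle
  exact hlt.not_ge hle

/-- For a DAG `E` and `h : V → Fin (k+1)` that is not monotone for the
reachability order (some ancestor `j` of `i` has `h j > h i`), the D-MLBN probability
vanishes for every choice of real parameters. -/
theorem stmt_8 {V : Type*} [Fintype V] (E : V → V → Prop)
    (hacyc : ∀ i : V, ¬ Relation.TransGen E i i) (k : ℕ)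
    (h : V → Fin (k + 1))
    (hnm : ∃ i j : V, Relation.TransGen E j i ∧ h i < h j)
    (θ : V → Fin (k + 1) → ℝ) :
    ∏ i : V, dmlbnFactor E h i (θ i) = 0 := by
  obtain ⟨i, j, hji, hlt⟩ := hnm
  obtain ⟨a, b, hab, hba⟩ := exists_edge_lt_of_transGen hji hlt
  exact Finset.prod_eq_zero (Finset.mem_univ b) (dmlbnFactor_eq_zero_of_lt hab hba (θ b))
end

section
/- Let V be a finite set and E a directed acyclic graph on V with parent sets pa(i), and fix k ≥ 1. Let g : V → Fin k be monotone with respect to the reachability order. Then for arbitrary real parameters θ^{(i)} = (θ_0^{(i)},...,θ_{k-1}^{(i)}) the following polynomial identity holds: ∑_{h : V → Fin k, h_i ≤ g_i for all i} ∏_{i ∈ V} c_i(h; θ^{(i)}) = ∏_{i ∈ V} ( ∑_{ℓ ≤ g_i} θ_ℓ^{(i)} ), where, with M_i(h) = max_{j ∈ pa(i)} h_j (equal to 0 if pa(i) = ∅), c_i(h; θ) = 0 if h_i < M_i(h); = θ_0 + ··· + θ_{M_i(h)} if h_i = M_i(h); = θ_{h_i} if h_i > M_i(h). -/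
open scoped Classical

/-- The local factor at a vertex whose parents take the maximum `M ≤ b` sums, over the states
up to `b`, to the cumulative parameter at `b`. -/
theorem sum_Iic_ite_lt_eq {k : ℕ} (θ : Fin (k + 1) → ℝ) {M b : Fin (k + 1)} (hM : M ≤ b) :
    ∑ x ∈ Finset.Iic b, (if x < M then 0 else if x = M then ∑ ℓ ∈ Finset.Iic M, θ ℓ else θ x)
      = ∑ ℓ ∈ Finset.Iic b, θ ℓ := by
  have hf : (Finset.Iic b).filter (fun x => x ≤ M) = Finset.Iic M := by
    ext x
    simp only [Finset.mem_filter, Finset.mem_Iic]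
    exact ⟨fun h => h.2, fun h => ⟨h.trans hM, h⟩⟩
  rw [← Finset.sum_filter_add_sum_filter_not (Finset.Iic b) (fun x => x ≤ M),
    ← Finset.sum_filter_add_sum_filter_not (Finset.Iic b) (fun x => x ≤ M) θ, hf]
  congr 1
  · rw [Finset.sum_eq_single_of_mem M (Finset.mem_Iic.2 le_rfl)]
    · simp
    · intro x hx hne
      rw [if_pos (lt_of_le_of_ne (Finset.mem_Iic.1 hx) hne)]
  · refine Finset.sum_congr rfl fun x hx => ?_
    have hx' : M < x := not_le.1 (Finset.mem_filter.1 hx).2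
    rw [if_neg hx'.not_gt, if_neg hx'.ne']

/-- Summing over one more coordinate of a product of finite sets. -/
theorem sum_piFinset_ite_insert {V : Type*} [Fintype V] {α β : Type*} [AddCommMonoid β]
    (t : V → Finset α) (a : α) {S : Finset V} {i : V} (hi : i ∉ S) (F : (V → α) → β) :
    ∑ h ∈ Fintype.piFinset (fun j => if j ∈ insert i S then t j else {a}), F h
      = ∑ h ∈ Fintype.piFinset (fun j => if j ∈ S then t j else {a}),
          ∑ x ∈ t i, F (Function.update h i x) := by
  rw [← Finset.sum_product']
  refine Finset.sum_nbij' (fun h => (Function.update h i a, h i))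
    (fun p => Function.update p.1 i p.2) ?_ ?_ ?_ ?_ ?_
  · intro h hh
    rw [Fintype.mem_piFinset] at hh
    rw [Finset.mem_product, Fintype.mem_piFinset]
    refine ⟨fun j => ?_, by simpa using hh i⟩
    by_cases hj : j = i
    · subst hj
      simp [hi]
    · simpa [hj] using hh j
  · rintro ⟨h, x⟩ hp
    rw [Finset.mem_product, Fintype.mem_piFinset] at hp
    rw [Fintype.mem_piFinset]
    intro j
    by_cases hj : j = i
    · subst hj
      simpa using hp.2
    · simpa [hj] using hp.1 j
  · intro h _
    simp
  · rintro ⟨h, x⟩ hp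
    rw [Finset.mem_product, Fintype.mem_piFinset] at hp
    have := hp.1 i
    simp only [hi, if_false, Finset.mem_singleton] at this
    simp [← this]
  · intro h _
    simp

/-- Changing the state of a vertex that is not a parent of `j` does not change the maximum over
the parents of `j`. -/
theorem sup_parents_update {V : Type*} [Fintype V] (E : V → V → Prop) {k : ℕ}
    (h : V → Fin (k + 1)) {i j : V} (hij : ¬ E i j) (x : Fin (k + 1)) :
    (Finset.univ.filter (fun l => E l j)).sup (Function.update h i x)
      = (Finset.univ.filter (fun l => E l j)).sup h := by
  refine Finset.sup_congr rfl fun l hl => ?_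
  rw [Function.update_of_ne]
  rintro rfl
  exact hij (Finset.mem_filter.1 hl).2

/-- The factorization over a parent-closed set of vertices, the other states being zero. -/
theorem sum_prod_dmlbnFactor_of_parent_closed {V : Type*} [Fintype V] (E : V → V → Prop)
    (hacyc : ∀ i : V, ¬ Relation.TransGen E i i) {k : ℕ} (g : V → Fin (k + 1))
    (hmono : ∀ i j : V, E j i → g j ≤ g i) (θ : V → Fin (k + 1) → ℝ) (S : Finset V)
    (hS : ∀ i ∈ S, ∀ j, E j i → j ∈ S) :
    ∑ h ∈ Fintype.piFinset (fun i => if i ∈ S then Finset.Iic (g i) else {0}),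
        ∏ i ∈ S, dmlbnFactor E h i (θ i)
      = ∏ i ∈ S, ∑ ℓ ∈ Finset.Iic (g i), θ i ℓ := by
  induction S using Finset.strongInduction with
  | H S ih =>
  rcases S.eq_empty_or_nonempty with rfl | hne
  · simp
  obtain ⟨i, hiS, hmax⟩ : ∃ i ∈ S, ∀ j ∈ S, ¬ E i j := by
    have : IsTrans V (fun a b => Relation.TransGen E b a) := ⟨fun _ _ _ h₁ h₂ => h₂.trans h₁⟩
    have : Std.Irrefl (fun a b => Relation.TransGen E b a) := ⟨hacyc⟩
    obtain ⟨i, hi, hmin⟩ := (Finite.wellFounded_of_trans_of_irrefl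
      (fun a b => Relation.TransGen E b a)).has_min (S : Set V) hne
    exact ⟨i, hi, fun j hj hE => hmin j hj (.single hE)⟩
  obtain ⟨T, hiT, rfl⟩ : ∃ T, i ∉ T ∧ insert i T = S :=
    ⟨S.erase i, Finset.notMem_erase i S, Finset.insert_erase hiS⟩
  have hT : ∀ l ∈ T, ∀ j, E j l → j ∈ T := fun l hl j hjl =>
    (Finset.mem_insert.1 (hS l (Finset.mem_insert_of_mem hl) j hjl)).resolve_left
      (by rintro rfl; exact hmax l (Finset.mem_insert_of_mem hl) hjl)
  rw [sum_piFinset_ite_insert _ _ hiT, Finset.prod_insert hiT,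
    ← ih T (Finset.ssubset_insert hiT) hT, Finset.mul_sum]
  refine Finset.sum_congr rfl fun h hh => ?_
  have hle : ∀ j, h j ≤ g j := fun j => by
    have := Fintype.mem_piFinset.1 hh j
    split_ifs at this
    · exact Finset.mem_Iic.1 this
    · rw [Finset.mem_singleton.1 this]
      exact Fin.zero_le _
  have hM : (Finset.univ.filter (fun j => E j i)).sup h ≤ g i :=
    Finset.sup_le fun j hj => (hle j).trans (hmono i j (Finset.mem_filter.1 hj).2)
  rw [← sum_Iic_ite_lt_eq (θ i) hM, Finset.sum_mul]
  refine Finset.sum_congr rfl fun x _ => ?_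
  rw [Finset.prod_insert hiT]
  congr 1
  · unfold dmlbnFactor
    rw [sup_parents_update E h (hmax i hiS), Function.update_self]
  · refine Finset.prod_congr rfl fun j hj => ?_
    unfold dmlbnFactor
    rw [sup_parents_update E h (hmax j (Finset.mem_insert_of_mem hj)), Function.update_of_ne]
    rintro rfl
    exact hiT hj

/-- For a DAG `E` and `g : V → Fin (k+1)` monotone for the reachability
order, and arbitrary real parameters `θ i`, the cumulative D-MLBN probability of the
lower set below `g` factors:
`∑_{h ≤ g} ∏_i c_i(h; θ^{(i)}) = ∏_i (∑_{ℓ ≤ g i} θ_ℓ^{(i)})`. -/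
theorem stmt_9 {V : Type*} [Fintype V] (E : V → V → Prop)
    (hacyc : ∀ i : V, ¬ Relation.TransGen E i i) (k : ℕ)
    (g : V → Fin (k + 1))
    (hmono : ∀ i j : V, Relation.TransGen E j i → g j ≤ g i)
    (θ : V → Fin (k + 1) → ℝ) :
    ∑ h ∈ Finset.univ.filter (fun h : V → Fin (k + 1) => ∀ i : V, h i ≤ g i),
        ∏ i : V, dmlbnFactor E h i (θ i)
      = ∏ i : V, ∑ ℓ ∈ Finset.Iic (g i), θ i ℓ := by
  rw [← sum_prod_dmlbnFactor_of_parent_closed E hacyc g (fun i j h => hmono i j (.single h)) θ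
    Finset.univ (fun _ _ _ _ => Finset.mem_univ _)]
  refine Finset.sum_congr ?_ fun _ _ => rfl
  ext h
  simp [Fintype.mem_piFinset]
end

section
/- Let P be a finite partially ordered set and k ≥ 1. For a monotone map g : P → Fin k define g̃ = {(i, r) ∈ P × Fin(k-1) : (r : ℕ) < k - 1 - (g_i : ℕ)}. Then: (1) g̃ is an order ideal of the product poset P × Fin(k-1) (ordered componentwise); (2) the map g ↦ g̃ is a bijection from the set of monotone maps P → Fin k onto the set of order ideals of P × Fin(k-1); and (3) it is order-reversing: for monotone g, g', g_i ≤ g'_i for all i ∈ P if and only if g̃ ⊇ g̃'. -/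
open scoped Classical

/-- Every lower set of `Fin k` is an initial segment. -/
theorem exists_le_forall_mem_iff_lt_of_isLowerSet {k : ℕ} {S : Set (Fin k)}
    (hS : IsLowerSet S) : ∃ c ≤ k, ∀ r : Fin k, r ∈ S ↔ (r : ℕ) < c := by
  have h : ∃ n, ∀ r ∈ S, (r : ℕ) < n := ⟨k, fun r _ => r.isLt⟩
  refine ⟨Nat.find h, Nat.find_min' h fun r _ => r.isLt, fun r =>
    ⟨Nat.find_spec h r, fun hr => ?_⟩⟩
  have hmin := Nat.find_min h hr
  push Not at hmin
  obtain ⟨s, hs, hrs⟩ := hmin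
  exact hS (Fin.le_def.2 hrs) hs

theorem isLowerSet_setOf_lt_sub {P : Type*} [Preorder P] {k : ℕ} {g : P → Fin (k + 1)}
    (hg : Monotone g) : IsLowerSet {pr : P × Fin k | (pr.2 : ℕ) < k - (g pr.1 : ℕ)} := by
  rintro ⟨i, r⟩ ⟨j, s⟩ ⟨hji, hsr⟩ h
  have hg' := Fin.le_def.1 (hg hji)
  have hsr' := Fin.le_def.1 hsr
  simp only [Set.mem_ofPred_eq] at h hg' hsr' ⊢
  omega

theorem forall_le_iff_setOf_lt_sub_subset {P : Type*} {k : ℕ} (g g' : P → Fin (k + 1)) :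
    (∀ i, g i ≤ g' i) ↔
      {pr : P × Fin k | (pr.2 : ℕ) < k - (g' pr.1 : ℕ)} ⊆
        {pr : P × Fin k | (pr.2 : ℕ) < k - (g pr.1 : ℕ)} := by
  constructor
  · rintro h ⟨i, r⟩ hr
    have hi := Fin.le_def.1 (h i)
    simp only [Set.mem_ofPred_eq] at hr ⊢
    omega
  · intro h i
    by_contra! hlt
    have hlt' := Fin.lt_def.1 hlt
    have hi := (g i).isLt
    have hr := @h (i, ⟨k - (g i : ℕ), by omega⟩)
    simp only [Set.mem_ofPred_eq] at hr
    omega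

theorem exists_monotone_setOf_lt_sub_eq {P : Type*} [Preorder P] {k : ℕ}
    {I : Set (P × Fin k)} (hI : IsLowerSet I) :
    ∃ g : P → Fin (k + 1), Monotone g ∧
      {pr : P × Fin k | (pr.2 : ℕ) < k - (g pr.1 : ℕ)} = I := by
  have hfiber (i : P) : IsLowerSet {r : Fin k | (i, r) ∈ I} :=
    fun _ _ hsr hr => hI (Prod.mk_le_mk.2 ⟨le_rfl, hsr⟩) hr
  choose c hck hc using fun i => exists_le_forall_mem_iff_lt_of_isLowerSet (hfiber i)
  refine ⟨fun i => ⟨k - c i, by omega⟩, fun i j hij => ?_, ?_⟩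
  · suffices c j ≤ c i from Fin.le_def.2 (Nat.sub_le_sub_left this k)
    by_contra! hlt
    have hmem : (j, (⟨c i, hlt.trans_le (hck j)⟩ : Fin k)) ∈ I := (hc j _).2 hlt
    exact lt_irrefl _ ((hc i _).1 (hI (Prod.mk_le_mk.2 ⟨hij, le_rfl⟩) hmem))
  · ext ⟨i, r⟩
    simp only [Set.mem_ofPred_eq, Nat.sub_sub_self (hck i)]
    exact (hc i r).symm

/-- For a finite poset `P` and `k ≥ 1` (states `Fin (k+1)`, second
factor `Fin k`), the assignment `g ↦ g̃ = {(i,r) : (r : ℕ) < k - g i}`: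
(1) sends each monotone map to an order ideal (lower set) of the product poset
`P × Fin k`; (2) is a bijection from monotone maps `P → Fin (k+1)` onto order ideals of
`P × Fin k`; and (3) is order-reversing: `g ≤ g'` pointwise iff `g̃' ⊆ g̃`. -/
theorem stmt_10 {P : Type*} [Fintype P] [PartialOrder P] (k : ℕ) :
    (∀ g : P → Fin (k + 1), Monotone g →
        IsLowerSet {pr : P × Fin k | (pr.2 : ℕ) < k - (g pr.1 : ℕ)}) ∧
      Set.BijOn
        (fun g : P → Fin (k + 1) => {pr : P × Fin k | (pr.2 : ℕ) < k - (g pr.1 : ℕ)})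
        {g : P → Fin (k + 1) | Monotone g} {I : Set (P × Fin k) | IsLowerSet I} ∧
      (∀ g g' : P → Fin (k + 1), Monotone g → Monotone g' →
        ((∀ i : P, g i ≤ g' i) ↔
          {pr : P × Fin k | (pr.2 : ℕ) < k - (g' pr.1 : ℕ)} ⊆
            {pr : P × Fin k | (pr.2 : ℕ) < k - (g pr.1 : ℕ)})) := by
  refine ⟨fun _ hg => isLowerSet_setOf_lt_sub hg,
    ⟨fun _ hg => isLowerSet_setOf_lt_sub hg, fun g _ g' _ h => ?_,
      fun _ hI => exists_monotone_setOf_lt_sub_eq hI⟩,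
    fun g g' _ _ => forall_le_iff_setOf_lt_sub_subset g g'⟩
  exact le_antisymm ((forall_le_iff_setOf_lt_sub_subset g g').2 h.ge)
    ((forall_le_iff_setOf_lt_sub_subset g' g).2 h.le)
end

section
/- Let P be a finite partially ordered set and k ≥ 1, and let G be the set of monotone maps from P to the chain Fin k; G is a distributive lattice under pointwise maximum ∨ and pointwise minimum ∧. Consider the ℝ-algebra homomorphism ψ from the polynomial ring ℝ[q_g : g ∈ G] to the polynomial ring ℝ[t, x_{(i,r)} : i ∈ P, r ∈ Fin(k-1)] defined by ψ(q_g) = t · ∏_{(i,r) : (r:ℕ) < k - 1 - (g_i : ℕ)} x_{(i,r)}. Then the kernel of ψ is the ideal generated by the quadratic binomials { q_g q_h − q_{g∧h} q_{g∨h} : g, h ∈ G incomparable }, where g and h are incomparable if neither g ≤ h nor h ≤ g pointwise. In particular, after homogenization and the linear change of coordinates q_g = ∑_{h ≤ g} p_h, the vanishing ideal of the k-state discrete max-linear Bayesian network on a DAG with transitive closure poset P is the toric (Hibi) ideal of the distributive lattice J(P × Fin(k-1)). -/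
open scoped Classical

/-- Given families `y` and `z` satisfying the Hibi relations, a product over `y` and the
corresponding sum over `z` can be rewritten simultaneously so that the infimum of all indices
occurs as one of the indices. -/
theorem exists_prod_sum_eq_inf_cons {L M N : Type*} [Lattice L] [OrderTop L] [CommMonoid M]
    [AddCommMonoid N] (y : L → M) (z : L → N)
    (hy : ∀ a b, y a * y b = y (a ⊓ b) * y (a ⊔ b))
    (hz : ∀ a b, z a + z b = z (a ⊓ b) + z (a ⊔ b)) (s : Multiset L) (a : L) :
    ∃ t : Multiset L,
      ((a ::ₘ s).map y).prod = (((a ::ₘ s).inf ::ₘ t).map y).prod ∧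
      ((a ::ₘ s).map z).sum = (((a ::ₘ s).inf ::ₘ t).map z).sum := by
  induction s using Multiset.induction_on generalizing a with
  | empty => exact ⟨0, by simp, by simp⟩
  | cons b s ih =>
    obtain ⟨t, hty, htz⟩ := ih b
    refine ⟨(a ⊔ (b ::ₘ s).inf) ::ₘ t, ?_, ?_⟩
    · rw [Multiset.map_cons, Multiset.prod_cons, hty, Multiset.inf_cons a]
      simp only [Multiset.map_cons, Multiset.prod_cons]
      rw [← mul_assoc, hy, mul_assoc]
    · rw [Multiset.map_cons, Multiset.sum_cons, htz, Multiset.inf_cons a]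
      simp only [Multiset.map_cons, Multiset.sum_cons]
      rw [← add_assoc, hz, add_assoc]

/-- If sums of `z` determine the number of summands and the infimum of the indices, then
every relation between sums of `z` holds for products of any family satisfying the Hibi
relations. -/
theorem prod_map_eq_of_hibi_relations {L M N : Type*} [Lattice L] [OrderTop L] [CommMonoid M]
    [AddCommMonoid N] [IsLeftCancelAdd N] (y : L → M) (z : L → N)
    (hy : ∀ a b, y a * y b = y (a ⊓ b) * y (a ⊔ b))
    (hz : ∀ a b, z a + z b = z (a ⊓ b) + z (a ⊔ b))
    (hcard : ∀ s s' : Multiset L, (s.map z).sum = (s'.map z).sum → s.card = s'.card)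
    (hinf : ∀ s s' : Multiset L, (s.map z).sum = (s'.map z).sum → s.inf = s'.inf)
    (s s' : Multiset L) (h : (s.map z).sum = (s'.map z).sum) :
    (s.map y).prod = (s'.map y).prod := by
  induction hn : s.card generalizing s s' with
  | zero =>
    have hn' := hcard _ _ h
    rw [hn] at hn'
    rw [Multiset.card_eq_zero.1 hn, Multiset.card_eq_zero.1 hn'.symm]
  | succ n ih =>
    have hcons (w : Multiset L) (hw : 0 < w.card) : ∃ a u, w = a ::ₘ u :=
      let ⟨a, ha⟩ := Multiset.card_pos_iff_exists_mem.1 hw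
      ⟨a, Multiset.exists_cons_of_mem ha⟩
    have hn' := hcard _ _ h
    obtain ⟨a, u, rfl⟩ := hcons s (by omega)
    obtain ⟨a', u', rfl⟩ := hcons s' (by omega)
    obtain ⟨t, hty, htz⟩ := exists_prod_sum_eq_inf_cons y z hy hz u a
    obtain ⟨t', hty', htz'⟩ := exists_prod_sum_eq_inf_cons y z hy hz u' a'
    have ht := hcard _ _ htz
    rw [hn, Multiset.card_cons] at ht
    have hm := hinf _ _ h
    rw [hty, hty', hm]
    rw [htz, htz', hm] at h
    simp only [Multiset.map_cons, Multiset.prod_cons, Multiset.sum_cons] at h ⊢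
    rw [ih t t' (add_left_cancel h) (by omega)]

/-- The kernel of a monomial map is contained in every ideal that contains all the binomials
in the kernel. -/
theorem MvPolynomial.ker_le_of_monomial_map {σ τ R : Type*} [CommRing R]
    (φ : MvPolynomial σ R →ₐ[R] MvPolynomial τ R) (v : σ → τ →₀ ℕ)
    (hφ : ∀ g, φ (X g) = monomial (v g) 1) (I : Ideal (MvPolynomial σ R))
    (hI : ∀ s s' : Multiset σ, (s.map v).sum = (s'.map v).sum →
      Ideal.Quotient.mk I (s.map X).prod = Ideal.Quotient.mk I (s'.map X).prod) :
    RingHom.ker φ.toRingHom ≤ I := by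
  have hX (s : Multiset σ) :
      monomial (Multiset.toFinsupp s) (1 : R) = (s.map X).prod := by
    induction s using Multiset.induction_on with
    | empty => simp
    | cons a s ih =>
      rw [Multiset.map_cons, Multiset.prod_cons, ← ih, X, monomial_mul, one_mul,
        ← Multiset.singleton_add, map_add, Multiset.toFinsupp_singleton]
  have hv (s : Multiset σ) : φ (s.map X).prod = monomial (s.map v).sum 1 := by
    induction s using Multiset.induction_on with
    | empty => simp
    | cons a s ih =>
      rw [Multiset.map_cons, Multiset.prod_cons, map_mul, ih, hφ, monomial_mul, one_mul,
        Multiset.map_cons, Multiset.sum_cons]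
  let θ : MvPolynomial τ R →ₗ[R] MvPolynomial σ R ⧸ I :=
    (basisMonomials τ R).constr R fun w =>
      if h : ∃ s : Multiset σ, (s.map v).sum = w then
        Ideal.Quotient.mk I (h.choose.map X).prod else 0
  have hθ : θ ∘ₗ φ.toLinearMap = (Ideal.Quotient.mkₐ R I).toLinearMap := by
    refine (basisMonomials σ R).ext fun w => ?_
    obtain ⟨s, rfl⟩ := Multiset.toFinsupp.surjective w
    have h : ∃ u : Multiset σ, (u.map v).sum = (s.map v).sum := ⟨s, rfl⟩
    have e := (basisMonomials τ R).constr_basis R (fun w =>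
      if h : ∃ s : Multiset σ, (s.map v).sum = w then
        Ideal.Quotient.mk I (h.choose.map X).prod else 0) (s.map v).sum
    rw [coe_basisMonomials] at e
    simp only [coe_basisMonomials, hX, LinearMap.comp_apply, AlgHom.toLinearMap_apply, hv]
    refine e.trans ?_
    rw [dif_pos h]
    exact hI _ _ h.choose_spec
  intro f hf
  have h0 : φ f = 0 := hf
  have := LinearMap.congr_fun hθ f
  rw [LinearMap.comp_apply, AlgHom.toLinearMap_apply, h0, map_zero] at this
  exact Ideal.Quotient.eq_zero_iff_mem.1 this.symm

/-- Modulo an ideal containing the Hibi binomials of incomparable pairs, the Hibi relations hold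
for all pairs. -/
theorem Ideal.Quotient.mk_X_mul_mk_X_eq {L R : Type*} [Lattice L] [CommRing R]
    {I : Ideal (MvPolynomial L R)}
    (hI : ∀ g h : L, ¬ g ≤ h → ¬ h ≤ g →
      MvPolynomial.X g * MvPolynomial.X h -
        MvPolynomial.X (g ⊓ h) * MvPolynomial.X (g ⊔ h) ∈ I) (a b : L) :
    mk I (MvPolynomial.X a) * mk I (MvPolynomial.X b) =
      mk I (MvPolynomial.X (a ⊓ b)) * mk I (MvPolynomial.X (a ⊔ b)) := by
  by_cases hab : a ≤ b
  · rw [inf_eq_left.2 hab, sup_eq_right.2 hab]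
  by_cases hba : b ≤ a
  · rw [inf_eq_right.2 hba, sup_eq_left.2 hba, mul_comm]
  rw [← map_mul, ← map_mul]
  exact Ideal.Quotient.eq.2 (hI a b hab hba)

section HibiExponent

variable {P : Type*} [Fintype P] [PartialOrder P] {k : ℕ}

/-- The exponent vector of the monomial attached to a monotone map `g`. -/
noncomputable def hibiExponent (g : P →o Fin (k + 1)) : Unit ⊕ P × Fin k →₀ ℕ :=
  Finsupp.equivFunOnFinite.symm
    (Sum.elim (fun _ => 1) fun pr => if (pr.2 : ℕ) < k - (g pr.1 : ℕ) then 1 else 0)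

theorem hibiExponent_inl (g : P →o Fin (k + 1)) (u : Unit) : hibiExponent g (Sum.inl u) = 1 :=
  rfl

theorem hibiExponent_inr (g : P →o Fin (k + 1)) (pr : P × Fin k) :
    hibiExponent g (Sum.inr pr) = if (pr.2 : ℕ) < k - (g pr.1 : ℕ) then 1 else 0 :=
  rfl

theorem monomial_hibiExponent {R : Type*} [CommSemiring R] (g : P →o Fin (k + 1)) :
    (MvPolynomial.monomial (hibiExponent g) 1 : MvPolynomial (Unit ⊕ P × Fin k) R) =
      MvPolynomial.X (Sum.inl ()) *
        ∏ pr ∈ Finset.univ.filter (fun pr : P × Fin k => (pr.2 : ℕ) < k - (g pr.1 : ℕ)),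
          MvPolynomial.X (Sum.inr pr) := by
  rw [MvPolynomial.monomial_eq, Finsupp.prod_fintype _ _ (by simp), Fintype.prod_sum_type,
    Finset.prod_filter]
  simp [hibiExponent_inl, hibiExponent_inr, pow_ite]

theorem hibiExponent_add (g h : P →o Fin (k + 1)) :
    hibiExponent g + hibiExponent h = hibiExponent (g ⊓ h) + hibiExponent (g ⊔ h) := by
  ext (u | ⟨i, r⟩)
  · rfl
  · simp only [Finsupp.add_apply, hibiExponent_inr]
    change _ = (if (r : ℕ) < k - ((g i ⊓ h i : Fin (k + 1)) : ℕ) then 1 else 0) +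
      (if (r : ℕ) < k - ((g i ⊔ h i : Fin (k + 1)) : ℕ) then 1 else 0)
    rcases le_total (g i) (h i) with e | e
    · rw [inf_eq_left.2 e, sup_eq_right.2 e]
    · rw [inf_eq_right.2 e, sup_eq_left.2 e, add_comm]

theorem sum_hibiExponent_apply (s : Multiset (P →o Fin (k + 1))) (x : Unit ⊕ P × Fin k) :
    (s.map hibiExponent).sum x = (s.map fun g => hibiExponent g x).sum := by
  simpa [Multiset.map_map] using
    map_multiset_sum (Finsupp.applyAddHom x) (s.map hibiExponent)

theorem card_eq_of_sum_hibiExponent_eq {s s' : Multiset (P →o Fin (k + 1))}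
    (h : (s.map hibiExponent).sum = (s'.map hibiExponent).sum) : s.card = s'.card := by
  have := DFunLike.congr_fun h (Sum.inl ())
  simpa [sum_hibiExponent_apply, hibiExponent_inl] using this

theorem inf_le_of_sum_hibiExponent_eq {s s' : Multiset (P →o Fin (k + 1))}
    (h : (s.map hibiExponent).sum = (s'.map hibiExponent).sum) : s'.inf ≤ s.inf := by
  refine Multiset.le_inf.2 fun g hg i => ?_
  suffices ∃ g' ∈ s', g' i ≤ g i by
    obtain ⟨g', hg', hle⟩ := this
    exact (Multiset.inf_le hg' i).trans hle
  by_cases hk : (g i : ℕ) < k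
  · have e := DFunLike.congr_fun h (Sum.inr (i, ⟨k - 1 - g i, by omega⟩))
    simp only [sum_hibiExponent_apply] at e
    by_contra! hc
    rw [Multiset.sum_eq_zero (s := s'.map _)] at e
    · have := Multiset.sum_eq_zero_iff.1 e _ (Multiset.mem_map_of_mem _ hg)
      rw [hibiExponent_inr, if_pos (by dsimp only; omega)] at this
      exact one_ne_zero this
    · intro n hn
      obtain ⟨g', hg', rfl⟩ := Multiset.mem_map.1 hn
      have := Fin.lt_def.1 (hc g' hg')
      rw [hibiExponent_inr, if_neg (by dsimp only; omega)]
  · obtain ⟨g', hg'⟩ := Multiset.card_pos_iff_exists_mem.1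
      (card_eq_of_sum_hibiExponent_eq h ▸ Multiset.card_pos_iff_exists_mem.2 ⟨g, hg⟩)
    exact ⟨g', hg', Fin.le_def.2 (by omega)⟩

theorem inf_eq_of_sum_hibiExponent_eq {s s' : Multiset (P →o Fin (k + 1))}
    (h : (s.map hibiExponent).sum = (s'.map hibiExponent).sum) : s.inf = s'.inf :=
  le_antisymm (inf_le_of_sum_hibiExponent_eq h.symm) (inf_le_of_sum_hibiExponent_eq h)

end HibiExponent

/-- **Hibi's theorem for the lattice of monotone maps / Theorem 4.2.**
Let `P` be a finite poset and `G = P →o Fin (k+1)` the distributive lattice of monotone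
maps from `P` to the chain with `k+1` elements (pointwise max and min).  The kernel of
the ring map `ψ : ℝ[q_g : g ∈ G] → ℝ[t, x_{(i,r)} : i ∈ P, r ∈ Fin k]` with
`ψ(q_g) = t · ∏_{(i,r) : (r : ℕ) < k - g i} x_{(i,r)}` is generated by the quadratic
binomials `q_g q_h − q_{g ⊓ h} q_{g ⊔ h}` over incomparable pairs `g, h`.  (This is the
toric ideal of `J(P × Fin k)`, hence, after homogenization and the Möbius change of
coordinates `q_g = ∑_{h ≤ g} p_h`, the vanishing ideal of the `(k+1)`-state D-MLBN on a
DAG with transitive closure poset `P`.) -/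
theorem stmt_11 {P : Type*} [Fintype P] [PartialOrder P] (k : ℕ) :
    RingHom.ker
        (MvPolynomial.aeval
          (fun g : P →o Fin (k + 1) =>
            (MvPolynomial.X (Sum.inl ()) *
              ∏ pr ∈ Finset.univ.filter
                  (fun pr : P × Fin k => (pr.2 : ℕ) < k - (g pr.1 : ℕ)),
                MvPolynomial.X (Sum.inr pr) :
              MvPolynomial (Unit ⊕ P × Fin k) ℝ))).toRingHom =
      Ideal.span {f : MvPolynomial (P →o Fin (k + 1)) ℝ |
        ∃ g h : P →o Fin (k + 1), ¬ g ≤ h ∧ ¬ h ≤ g ∧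
          f = MvPolynomial.X g * MvPolynomial.X h -
                MvPolynomial.X (g ⊓ h) * MvPolynomial.X (g ⊔ h)} := by
  apply le_antisymm
  · refine MvPolynomial.ker_le_of_monomial_map _ hibiExponent
      (fun g => by rw [MvPolynomial.aeval_X, monomial_hibiExponent]) _ fun s s' h => ?_
    rw [map_multiset_prod, map_multiset_prod, Multiset.map_map, Multiset.map_map]
    refine prod_map_eq_of_hibi_relations _ hibiExponent ?_ hibiExponent_add
      (fun _ _ => card_eq_of_sum_hibiExponent_eq) (fun _ _ => inf_eq_of_sum_hibiExponent_eq) s s' h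
    exact Ideal.Quotient.mk_X_mul_mk_X_eq fun g h hgh hhg =>
      Ideal.subset_span ⟨g, h, hgh, hhg, rfl⟩
  · rw [Ideal.span_le]
    rintro _ ⟨g, h, -, -, rfl⟩
    change MvPolynomial.aeval _ _ = 0
    simp only [map_sub, map_mul, MvPolynomial.aeval_X, ← monomial_hibiExponent,
      MvPolynomial.monomial_mul, hibiExponent_add g h, sub_self]
end

section
/- Let P be a finite partially ordered set and k ≥ 1, and let G be the set of monotone maps from P to Fin k. Consider the two ℝ-algebra homomorphisms from ℝ[q_g : g ∈ G]: the map A into ℝ[t, α_{(i,j)} : i ∈ P, j ∈ Fin(k-1)] defined by A(q_g) = t · ∏_{i ∈ P with g_i ≠ k-1} α_{(i, g_i)}, and the map B into ℝ[t, x_{(i,r)} : i ∈ P, r ∈ Fin(k-1)] defined by B(q_g) = t · ∏_{(i,r) : (r:ℕ) < k - 1 - (g_i:ℕ)} x_{(i,r)}. Then ker A = ker B. -/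
open scoped Classical

/-- A substitution of monomials whose exponent vectors are linearly independent is injective. -/
theorem MvPolynomial.aeval_monomial_injective {σ τ R : Type*} [CommSemiring R] {v : σ → τ →₀ ℕ}
    (hv : LinearIndependent ℕ v) :
    Function.Injective (aeval (R := R) fun s => monomial (v s) (1 : R)) := by
  have h : aeval (R := R) (fun s => monomial (v s) (1 : R)) =
      AddMonoidAlgebra.mapDomainAlgHom R R (Finsupp.linearCombination ℕ v).toAddMonoidHom := by
    refine MvPolynomial.algHom_ext fun s => ?_
    rw [aeval_X]
    refine .trans ?_ (AddMonoidAlgebra.mapDomain_single (f := Finsupp.linearCombination ℕ v)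
      (a := Finsupp.single s 1) (r := (1 : R))).symm
    rw [Finsupp.linearCombination_single, one_smul]
    rfl
  rw [h]
  exact AddMonoidAlgebra.mapDomain_injective hv

theorem Fin.sum_filter_lt_succ {M : Type*} [AddCommMonoid M] {k : ℕ} (f : Fin k → M) (j : Fin k) :
    ∑ l ∈ Finset.univ.filter (fun l : Fin k => (l : ℕ) < j + 1), f l =
      f j + ∑ l ∈ Finset.univ.filter (fun l : Fin k => (l : ℕ) < j), f l := by
  rw [← Finset.sum_insert (by simp)]
  congr 1
  ext l
  simp only [Finset.mem_filter_univ, Finset.mem_insert, Fin.ext_iff]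
  omega

/-- The exponent vectors of the triangular substitution `t ↦ t`,
`α_{(i,j)} ↦ ∏_{r < k - j} x_{(i,r)}`. -/
noncomputable def cumulativeExponent (P : Type*) (k : ℕ) :
    Unit ⊕ P × Fin k → Unit ⊕ P × Fin k →₀ ℕ
  | .inl _ => Finsupp.single (Sum.inl ()) 1
  | .inr (i, j) => ∑ r ∈ Finset.univ.filter (fun r : Fin k => (r : ℕ) < k - (j : ℕ)),
      Finsupp.single (Sum.inr (i, r)) 1

theorem cumulativeExponent_inl (P : Type*) (k : ℕ) (u : Unit) :
    cumulativeExponent P k (Sum.inl u) = Finsupp.single (Sum.inl ()) 1 := rfl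

theorem cumulativeExponent_inr_apply_inl {P : Type*} {k : ℕ} (p : P × Fin k) (u : Unit) :
    cumulativeExponent P k (Sum.inr p) (Sum.inl u) = 0 := by
  simp [cumulativeExponent, Finsupp.finsetSum_apply]

theorem cumulativeExponent_inr_apply_inr {P : Type*} {k : ℕ} (i i' : P) (j r : Fin k) :
    cumulativeExponent P k (Sum.inr (i, j)) (Sum.inr (i', r)) =
      if i = i' ∧ (r : ℕ) < k - (j : ℕ) then 1 else 0 := by
  by_cases h : i = i' <;>
    simp [cumulativeExponent, Finsupp.finsetSum_apply, Finsupp.single_apply, h]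

theorem linearIndependent_cumulativeExponent (P : Type*) [Fintype P] (k : ℕ) :
    LinearIndependent ℕ (cumulativeExponent P k) := by
  rw [Fintype.linearIndependent_iffₛ]
  intro f g hfg
  have hr (i : P) (r : Fin k) :
      ∑ j ∈ Finset.univ.filter (fun j : Fin k => (j : ℕ) < k - (r : ℕ)), f (Sum.inr (i, j)) =
        ∑ j ∈ Finset.univ.filter (fun j : Fin k => (j : ℕ) < k - (r : ℕ)),
          g (Sum.inr (i, j)) := by
    have := DFunLike.congr_fun hfg (Sum.inr (i, r))
    simpa [cumulativeExponent_inr_apply_inr, Finsupp.finsetSum_apply, Fintype.sum_prod_type,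
      ite_and, Finset.sum_ite_irrel, Finset.sum_filter, lt_tsub_comm (a := (r : ℕ)),
      cumulativeExponent_inl] using this
  have hn (i : P) (n : ℕ) (hnk : n ≤ k) :
      ∑ j ∈ Finset.univ.filter (fun j : Fin k => (j : ℕ) < n), f (Sum.inr (i, j)) =
        ∑ j ∈ Finset.univ.filter (fun j : Fin k => (j : ℕ) < n), g (Sum.inr (i, j)) := by
    obtain rfl | h0 := n.eq_zero_or_pos
    · simp
    · simpa only [Nat.sub_sub_self hnk] using hr i ⟨k - n, by omega⟩
  rintro (_ | ⟨i, j⟩)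
  · have := DFunLike.congr_fun hfg (Sum.inl ())
    simpa [cumulativeExponent_inl, cumulativeExponent_inr_apply_inl, Finsupp.finsetSum_apply]
      using this
  · have h := hn i (j + 1) j.isLt
    rw [Fin.sum_filter_lt_succ (fun l => f (Sum.inr (i, l))),
      Fin.sum_filter_lt_succ (fun l => g (Sum.inr (i, l))), hn i j j.isLt.le] at h
    exact Nat.add_right_cancel h

theorem exists_injective_algHom_cumulative (R P : Type*) [CommSemiring R] [Fintype P] (k : ℕ) :
    ∃ φ : MvPolynomial (Unit ⊕ P × Fin k) R →ₐ[R] MvPolynomial (Unit ⊕ P × Fin k) R,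
      Function.Injective φ ∧
      φ (MvPolynomial.X (Sum.inl ())) = MvPolynomial.X (Sum.inl ()) ∧
      ∀ (i : P) (j : Fin k), φ (MvPolynomial.X (Sum.inr (i, j))) =
        ∏ r ∈ Finset.univ.filter (fun r : Fin k => (r : ℕ) < k - (j : ℕ)),
          MvPolynomial.X (Sum.inr (i, r)) := by
  refine ⟨_, MvPolynomial.aeval_monomial_injective (linearIndependent_cumulativeExponent P k),
    MvPolynomial.aeval_X _ _, fun i j => (MvPolynomial.aeval_X _ _).trans ?_⟩
  rw [cumulativeExponent, MvPolynomial.monomial_sum_one]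
  rfl

/-- Let `P` be a finite poset, `k ≥ 1` (states `Fin (k+1)`), and `G`
the set of monotone maps `P → Fin (k+1)`.  The two ℝ-algebra maps from `ℝ[q_g : g ∈ G]`
given by `A(q_g) = t · ∏_{i : g i ≠ k} α_{(i, g i)}` (into `ℝ[t, α_{(i,j)}]`) and
`B(q_g) = t · ∏_{(i,r) : (r : ℕ) < k - g i} x_{(i,r)}` (into `ℝ[t, x_{(i,r)}]`) have the
same kernel. -/
theorem stmt_12 {P : Type*} [Fintype P] [PartialOrder P] (k : ℕ) :
    RingHom.ker
        (MvPolynomial.aeval (R := ℝ)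
          (fun g : P →o Fin (k + 1) =>
            (MvPolynomial.X (Sum.inl ()) *
              ∏ i : P,
                if h : (g i : ℕ) < k then
                  MvPolynomial.X (Sum.inr (i, (⟨(g i : ℕ), h⟩ : Fin k)))
                else 1 :
              MvPolynomial (Unit ⊕ P × Fin k) ℝ))).toRingHom =
      RingHom.ker
        (MvPolynomial.aeval (R := ℝ)
          (fun g : P →o Fin (k + 1) =>
            (MvPolynomial.X (Sum.inl ()) *
              ∏ pr ∈ Finset.univ.filter
                  (fun pr : P × Fin k => (pr.2 : ℕ) < k - (g pr.1 : ℕ)),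
                MvPolynomial.X (Sum.inr pr) :
              MvPolynomial (Unit ⊕ P × Fin k) ℝ))).toRingHom := by
  obtain ⟨φ, hφ, hφt, hφα⟩ := exists_injective_algHom_cumulative ℝ P k
  refine (RingHom.ker_comp_of_injective _ (f := φ.toRingHom) hφ).symm.trans ?_
  refine congrArg (fun ψ : _ →ₐ[ℝ] _ => RingHom.ker ψ.toRingHom)
    ((MvPolynomial.comp_aeval _ φ).trans (congrArg _ (funext fun g => ?_)))
  rw [map_mul, hφt, map_prod, Finset.prod_filter, Fintype.prod_prod_type]
  congr 1
  refine Finset.prod_congr rfl fun i _ => ?_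
  split_ifs with h
  · rw [hφα, Finset.prod_filter]
  · simp [Nat.sub_eq_zero_of_le (not_lt.mp h)]
end

section
/- Let V be a finite set and E a directed acyclic graph on V with parent sets pa(i) and ancestor sets an(i), and fix k ≥ 1. For each i ∈ V let θ^{(i)} be a probability mass function on Fin k, let μ be the product probability measure ⊗_{i∈V} θ^{(i)} on (Fin k)^V, and let X : (Fin k)^V → (Fin k)^V be defined by X(z)_i = max_{j ∈ {i} ∪ an(i)} z_j. Then for every g : V → Fin k, the pushforward measure satisfies (X_*μ)({g}) = ∏_{i ∈ V} c_i(g; θ^{(i)}), where, with M_i(g) = max_{j ∈ pa(i)} g_j (equal to 0 if pa(i) = ∅), c_i(g; θ) = 0 if g_i < M_i(g); = ∑_{ℓ ≤ M_i(g)} θ(ℓ) if g_i = M_i(g); = θ(g_i) if g_i > M_i(g). -/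
open scoped Classical ENNReal

/-- The D-MLBN local factor `c_i(g; θ)` of formula (4), with values in `ℝ≥0∞` for a
probability mass function `θ`: with `M_i = max_{j ∈ pa(i)} g j` (`= 0` for empty parent
set), it is `0` if `g i < M_i`, `∑_{ℓ ≤ M_i} θ ℓ` if `g i = M_i`, and `θ (g i)` if
`g i > M_i`. -/
noncomputable def dmlbnFactorE {V : Type*} [Fintype V] (E : V → V → Prop) {k : ℕ}
    (g : V → Fin (k + 1)) (i : V) (θ : PMF (Fin (k + 1))) : ℝ≥0∞ :=
  if g i < (Finset.univ.filter (fun j => E j i)).sup g then 0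
  else if g i = (Finset.univ.filter (fun j => E j i)).sup g then
    ∑ ℓ ∈ Finset.Iic ((Finset.univ.filter (fun j => E j i)).sup g), θ ℓ
  else θ (g i)

/-- The ancestral maximum of `z` is the unique solution of the recursive max-linear equations. -/
theorem eq_sup_ancestors_iff {V α : Type*} [Fintype V] [LinearOrder α] [OrderBot α]
    (E : V → V → Prop) (hacyc : ∀ i : V, ¬ Relation.TransGen E i i) (z g : V → α) :
    (fun i : V => (insert i (Finset.univ.filter (fun j => Relation.TransGen E j i))).sup z) = g ↔
      ∀ i, (Finset.univ.filter (fun j => E j i)).sup g ⊔ z i = g i := by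
  constructor
  · rintro rfl i
    apply le_antisymm
    · refine sup_le (Finset.sup_le fun j hj => Finset.sup_mono fun l hl => ?_)
        (Finset.le_sup (Finset.mem_insert_self _ _))
      have hj : E j i := by simpa using hj
      rcases Finset.mem_insert.1 hl with rfl | hl
      · simpa using Or.inr (Relation.TransGen.single hj)
      · have hl : Relation.TransGen E l j := by simpa using hl
        simpa using Or.inr (hl.tail hj)
    · refine Finset.sup_le fun l hl => ?_
      rcases Finset.mem_insert.1 hl with rfl | hl
      · exact le_sup_right
      · have hl : Relation.TransGen E l i := by simpa using hl
        obtain ⟨j, hlj, hji⟩ := Relation.TransGen.tail'_iff.1 hl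
        refine le_sup_of_le_left ?_
        refine le_trans ?_ (Finset.le_sup (b := j) (by simpa using hji))
        refine Finset.le_sup (f := z) ?_
        rcases Relation.reflTransGen_iff_eq_or_transGen.1 hlj with rfl | h
        · exact Finset.mem_insert_self _ _
        · simpa using Or.inr h
  · intro h
    have hz : ∀ i, z i ≤ g i := fun i => le_sup_right.trans (h i).le
    have hE : ∀ {j i}, E j i → g j ≤ g i := fun {j i} hji =>
      (Finset.le_sup (f := g) (Finset.mem_filter.2 ⟨Finset.mem_univ j, hji⟩)).trans (le_sup_left.trans (h i).le)
    have hT : ∀ {j i}, Relation.TransGen E j i → g j ≤ g i := fun {j i} hji => by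
      induction hji with
      | single h => exact hE h
      | tail _ h ih => exact ih.trans (hE h)
    funext i
    apply le_antisymm
    · refine Finset.sup_le fun l hl => ?_
      rcases Finset.mem_insert.1 hl with rfl | hl
      · exact hz _
      · exact (hz l).trans (hT (by simpa using hl))
    · have : Std.Irrefl (Relation.TransGen E) := ⟨hacyc⟩
      have wf : WellFounded (Relation.TransGen E) := Finite.wellFounded_of_trans_of_irrefl _
      induction i using wf.induction with
      | _ i ih =>
        rw [← h i]
        refine sup_le (Finset.sup_le fun j hj => ?_)
          (Finset.le_sup (Finset.mem_insert_self _ _))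
        have hj : E j i := by simpa using hj
        refine (ih j (.single hj)).trans (Finset.sup_mono fun l hl => ?_)
        rcases Finset.mem_insert.1 hl with rfl | hl
        · simpa using Or.inr (Relation.TransGen.single hj)
        · have hl : Relation.TransGen E l j := by simpa using hl
          simpa using Or.inr (hl.tail hj)

/-- The local factor is the probability that the innovation, joined with the parental maximum,
yields the value `g i`. -/
theorem toMeasure_sup_eq_dmlbnFactorE {V : Type*} [Fintype V] (E : V → V → Prop) {k : ℕ}
    (g : V → Fin (k + 1)) (i : V) (θ : PMF (Fin (k + 1))) :
    θ.toMeasure {a | (Finset.univ.filter (fun j => E j i)).sup g ⊔ a = g i} =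
      dmlbnFactorE E g i θ := by
  unfold dmlbnFactorE
  generalize (Finset.univ.filter (fun j => E j i)).sup g = m
  split_ifs with h₁ h₂
  · have : {a | m ⊔ a = g i} = ∅ :=
      Set.eq_empty_of_forall_notMem fun a ha => (le_sup_left.trans_eq ha).not_gt h₁
    rw [this, MeasureTheory.measure_empty]
  · have : {a | m ⊔ a = g i} = (Finset.Iic m : Set (Fin (k + 1))) := by
      ext a
      simp [h₂]
    rw [this, PMF.toMeasure_apply_finset]
  · have : {a | m ⊔ a = g i} = {g i} := by
      ext a
      have : m < g i := lt_of_le_of_ne (not_lt.1 h₁) (Ne.symm h₂)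
      simp only [Set.mem_ofPred_eq, Set.mem_singleton_iff]
      constructor
      · intro ha
        rcases max_choice m a with h | h
        · exact absurd (h.symm.trans ha) this.ne
        · exact h.symm.trans ha
      · rintro rfl
        exact max_eq_right this.le
    rw [this, PMF.toMeasure_apply_singleton _ _ (MeasurableSet.singleton _)]

/-- For a DAG `E` on a finite vertex set `V`, independent innovations
`Z i ∼ θ i` (product measure `μ = ⊗_i θ i` on `(Fin (k+1))^V`), and the max-linear map
`X(z)_i = max_{j ∈ {i} ∪ an(i)} z j`, the pushforward measure of every state `g` is the
product of the D-MLBN conditional probabilities: `(X_*μ)({g}) = ∏_i c_i(g; θ i)`. -/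
theorem stmt_13 {V : Type*} [Fintype V] (E : V → V → Prop)
    (hacyc : ∀ i : V, ¬ Relation.TransGen E i i) (k : ℕ)
    (θ : V → PMF (Fin (k + 1))) (g : V → Fin (k + 1)) :
    MeasureTheory.Measure.map
        (fun z : V → Fin (k + 1) => fun i : V =>
          (insert i (Finset.univ.filter (fun j => Relation.TransGen E j i))).sup z)
        (MeasureTheory.Measure.pi (fun i : V => (θ i).toMeasure)) {g}
      = ∏ i : V, dmlbnFactorE E g i (θ i) := by
  rw [MeasureTheory.Measure.map_apply .of_discrete (MeasurableSet.singleton _)]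
  have hpre : (fun z : V → Fin (k + 1) => fun i : V =>
        (insert i (Finset.univ.filter (fun j => Relation.TransGen E j i))).sup z) ⁻¹' {g} =
      Set.univ.pi fun i => {a | (Finset.univ.filter (fun j => E j i)).sup g ⊔ a = g i} := by
    ext z
    simpa using eq_sup_ancestors_iff E hacyc z g
  rw [hpre, MeasureTheory.Measure.pi_pi]
  exact Finset.prod_congr rfl fun i _ => toMeasure_sup_eq_dmlbnFactorE E g i (θ i)
end

section
/- Let V be a finite set and E a directed acyclic graph on V with ancestor sets an(i), and fix k ≥ 1. For each i ∈ V let θ^{(i)} be a probability mass function on Fin k and let μ be the product probability measure ⊗_{i∈V} θ^{(i)} on (Fin k)^V. Let g : V → Fin k be monotone with respect to the reachability order. Then μ({z : max_{j ∈ {i} ∪ an(i)} z_j ≤ g_i for all i ∈ V}) = ∏_{i ∈ V} ∑_{ℓ ≤ g_i} θ^{(i)}(ℓ). -/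
open scoped Classical ENNReal

/-- For a DAG `E` on a finite vertex set `V`, independent innovations
`Z i ∼ θ i` (product measure `μ = ⊗_i θ i` on `(Fin (k+1))^V`), and `g : V → Fin (k+1)`
monotone for the reachability order, the probability that
`max_{j ∈ {i} ∪ an(i)} Z j ≤ g i` for all `i` factors as `∏_i ∑_{ℓ ≤ g i} θ i ℓ`. -/
theorem stmt_14 {V : Type*} [Fintype V] (E : V → V → Prop)
    (hacyc : ∀ i : V, ¬ Relation.TransGen E i i) (k : ℕ)
    (θ : V → PMF (Fin (k + 1))) (g : V → Fin (k + 1))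
    (hmono : ∀ i j : V, Relation.TransGen E j i → g j ≤ g i) :
    MeasureTheory.Measure.pi (fun i : V => (θ i).toMeasure)
        {z : V → Fin (k + 1) |
          ∀ i : V,
            (insert i (Finset.univ.filter (fun j => Relation.TransGen E j i))).sup z ≤ g i}
      = ∏ i : V, ∑ ℓ ∈ Finset.Iic (g i), θ i ℓ := by
  have hset : {z : V → Fin (k + 1) |
      ∀ i : V,
        (insert i (Finset.univ.filter (fun j => Relation.TransGen E j i))).sup z ≤ g i}
      = Set.univ.pi fun i => (Finset.Iic (g i) : Set (Fin (k + 1))) := by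
    ext z
    simp only [Set.mem_ofPred_eq, Finset.sup_le_iff, Finset.mem_insert, Finset.mem_filter,
      Finset.mem_univ, true_and, Set.mem_univ_pi, Finset.mem_coe, Finset.mem_Iic]
    refine ⟨fun h i => h i i (Or.inl rfl), fun h i j hj => ?_⟩
    rcases hj with rfl | hj
    · exact h j
    · exact (h j).trans (hmono i j hj)
  rw [hset, MeasureTheory.Measure.pi_pi]
  exact Finset.prod_congr rfl fun i _ => PMF.toMeasure_apply_finset (θ i) _
end
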